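/- arXiv:2102.06193 — 3 statements merged into one kernel-verified Lean document; each statement's English description precedes it below -/
import Mathlib

section
/- For every integer n ≥ 1, the sequence F^n is a feasible solution of the linear program (LP^{L²}_n): F_k^n ≥ 0 for all k, ∑_{k=0}^{n} F_k^n = 1, and ∑_{k=0}^{n} F_k^n 𝓛_k(x) ≥ 0 for every x ≥ 0. Consequently, ω_n^{L²} ≥ F_n^n = 2^{−n} · C(n, ⌊n/2⌋) ≥ 1/(n+1). -/
/-- The `k`-th Laguerre polynomial: `L_k(x) = ∑_{l=0}^k ((-1)^l / l!) C(k,l) x^l`. -/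
noncomputable def laguerreL (k : ℕ) (x : ℝ) : ℝ :=
  ∑ l ∈ Finset.range (k + 1), ((-1 : ℝ) ^ l / (l.factorial : ℝ)) * (k.choose l : ℝ) * x ^ l

/-- The `k`-th Laguerre function: `𝓛_k(x) = (-1)^k L_k(x) e^{-x/2}`. -/
noncomputable def laguerreFun (k : ℕ) (x : ℝ) : ℝ :=
  (-1 : ℝ) ^ k * laguerreL k x * Real.exp (-x / 2)

/-- The sequence `F^n`: for even `n`, `F_k^n = 2^{-n} C(k,k/2) C(n−k,(n−k)/2)` for even
`k ≤ n` and `0` otherwise; for odd `n`, `F_k^n = 2^{-n} C(n,⌊n/2⌋) C(⌊n/2⌋,⌊k/2⌋)²/C(n,k)`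
for `k ≤ n` and `0` for `k > n`. -/
noncomputable def Fseq (n : ℕ) : ℕ → ℝ := fun k =>
  if n % 2 = 0 then
    (if k ≤ n ∧ k % 2 = 0 then
      ((k.choose (k / 2) : ℝ) * ((n - k).choose ((n - k) / 2) : ℝ)) / 2 ^ n
    else 0)
  else
    (if k ≤ n then
      ((n.choose (n / 2) : ℝ) * ((n / 2).choose (k / 2) : ℝ) ^ 2) / (2 ^ n * (n.choose k : ℝ))
    else 0)

/-- `ω_n^{L²}`: the optimal value of the infinite-dimensional linear program `(LP^{L²}_n)`. -/
noncomputable def lpVal (n : ℕ) : ℝ :=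
  sSup {v : ℝ | ∃ F : ℕ → ℝ, (∀ k, 0 ≤ F k) ∧ (∑' k, F k) = 1 ∧
    (∀ x : ℝ, 0 ≤ x → 0 ≤ ∑' k, F k * laguerreFun k x) ∧ v = F n}

open Polynomial in
/-- The rescaled Laguerre polynomial `L_k(c x)` as an element of `ℝ[X]`. -/
noncomputable def laguerrePoly (c : ℝ) (k : ℕ) : ℝ[X] :=
  ∑ l ∈ Finset.range (k + 1), monomial l ((-c) ^ l / (l.factorial : ℝ) * (k.choose l : ℝ))

/-- The normalized products `4^{-m} C(2j, j) C(2m - 2j, m - j)`. -/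
noncomputable def arcsineWeight (m j : ℕ) : ℝ :=
  (j.centralBinom : ℝ) * ((m - j).centralBinom : ℝ) / 4 ^ m

/-- The binomial moments of `2j` with respect to `arcsineWeight m`. -/
noncomputable def arcsineMoment (m l : ℕ) : ℝ :=
  ∑ j ∈ Finset.range (m + 1), arcsineWeight m j * ((2 * j).choose l : ℝ)

section LaguerrePoly

open Polynomial

lemma laguerrePoly_coeff (c : ℝ) (k l : ℕ) :
    (laguerrePoly c k).coeff l = (-c) ^ l / (l.factorial : ℝ) * (k.choose l : ℝ) := by
  rw [laguerrePoly, finsetSum_coeff]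
  simp only [coeff_monomial, Finset.sum_ite_eq', Finset.mem_range]
  split_ifs with h
  · rfl
  · rw [Nat.choose_eq_zero_of_lt (by omega)]
    simp

lemma laguerrePoly_natDegree_le (c : ℝ) (k : ℕ) : (laguerrePoly c k).natDegree ≤ k := by
  rw [natDegree_le_iff_coeff_eq_zero]
  intro l hl
  rw [laguerrePoly_coeff, Nat.choose_eq_zero_of_lt hl]
  simp

lemma laguerrePoly_one_eval (k : ℕ) (x : ℝ) : (laguerrePoly 1 k).eval x = laguerreL k x := by
  simp [laguerrePoly, laguerreL, eval_finsetSum]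

lemma laguerrePoly_eval_zero (c : ℝ) (k : ℕ) : (laguerrePoly c k).eval 0 = 1 := by
  rw [← coeff_zero_eq_eval_zero, laguerrePoly_coeff]
  simp

lemma cast_choose_succ_mul (k l : ℕ) :
    ((k.choose (l + 1) : ℕ) : ℝ) * (l + 1) = (k.choose l : ℝ) * ((k : ℝ) - l) := by
  rcases le_or_gt l k with h | h
  · have := Nat.choose_succ_right_eq k l
    rw [← Nat.cast_sub h]
    exact_mod_cast this
  · rw [Nat.choose_eq_zero_of_lt h, Nat.choose_eq_zero_of_lt (by omega)]
    simp

lemma laguerrePoly_coeff_succ (c : ℝ) (k l : ℕ) :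
    ((l : ℝ) + 1) ^ 2 * (laguerrePoly c k).coeff (l + 1)
      = c * ((l : ℝ) - k) * (laguerrePoly c k).coeff l := by
  have h := cast_choose_succ_mul k l
  rw [laguerrePoly_coeff, laguerrePoly_coeff, Nat.factorial_succ, pow_succ]
  push_cast
  have : (l.factorial : ℝ) ≠ 0 := by positivity
  field_simp
  linear_combination -(-c) ^ l * c * h

/-- Laguerre's differential equation. -/
lemma laguerrePoly_ode (c : ℝ) (k : ℕ) :
    X * derivative (derivative (laguerrePoly c k))
      + (1 - C c * X) * derivative (laguerrePoly c k)
      + C (c * k) * laguerrePoly c k = 0 := by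
  ext l
  have h := laguerrePoly_coeff_succ c k l
  rcases l with _ | l
  · simp only [sub_mul, one_mul, mul_assoc, coeff_add, coeff_sub, coeff_C_mul, coeff_X_mul_zero,
      coeff_derivative, coeff_zero] at h ⊢
    push_cast at h ⊢
    linear_combination h
  · simp only [sub_mul, one_mul, mul_assoc, coeff_add, coeff_sub, coeff_C_mul, coeff_X_mul,
      coeff_derivative, coeff_zero] at h ⊢
    push_cast at h ⊢
    linear_combination h

lemma laguerrePoly_succ (k : ℕ) :
    C ((k : ℝ) + 1) * laguerrePoly 1 (k + 1)
      = X * derivative (laguerrePoly 1 k) + (C ((k : ℝ) + 1) - X) * laguerrePoly 1 k := by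
  ext l
  rcases l with _ | l
  · simp [sub_mul, laguerrePoly_coeff]
  · have h := cast_choose_succ_mul k l
    simp only [sub_mul, coeff_add, coeff_sub, coeff_C_mul, coeff_X_mul, coeff_derivative,
      laguerrePoly_coeff, Nat.choose_succ_succ', Nat.factorial_succ, pow_succ]
    push_cast
    have : (l.factorial : ℝ) ≠ 0 := by positivity
    field_simp
    linear_combination h

/-- The third-order differential equation satisfied by the square of a Laguerre polynomial. -/
lemma laguerrePoly_half_sq_ode (m : ℕ) (w : ℝ[X]) (hw : w = laguerrePoly (1 / 2) m ^ 2) :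
    2 * (X * (X * derivative (derivative (derivative w))))
      + 6 * (X * derivative (derivative w)) - 3 * (X * (X * derivative (derivative w)))
      + 2 * derivative w + C (4 * (m : ℝ) - 4) * (X * derivative w)
      + X * (X * derivative w) + C (2 * (m : ℝ)) * w - C (2 * (m : ℝ)) * (X * w) = 0 := by
  subst hw
  have h := laguerrePoly_ode (1 / 2) m
  have h' := congrArg derivative h
  have hc : C ((1 : ℝ) / 2) * 2 = 1 := by
    rw [show (2 : ℝ[X]) = C 2 from rfl, ← C_mul]; norm_num
  simp only [derivative_mul, derivative_add, derivative_sub, derivative_X, derivative_C,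
    derivative_one, derivative_zero, C_mul, C_sub, pow_two, one_mul, zero_mul, mul_one,
    zero_add, zero_sub, show C (4 : ℝ) = 4 from rfl, show C (2 : ℝ) = 2 from rfl] at h h' ⊢
  generalize derivative (derivative (derivative (laguerrePoly (1 / 2) m))) = y3 at *
  generalize derivative (derivative (laguerrePoly (1 / 2) m)) = y2 at *
  generalize derivative (laguerrePoly (1 / 2) m) = y1 at *
  generalize laguerrePoly (1 / 2) m = y at *
  generalize C ((1 : ℝ) / 2) = c at *
  generalize C (m : ℝ) = M at *
  linear_combination (12 * X * y1 + (4 - 4 * X) * y) * h + 4 * X * y * h'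
    - ((6 * X * y1 + (2 - 2 * X) * y) * (-X * y1 + M * y)
      + 2 * X * y * (-y1 - X * y2 + M * y1)) * hc

lemma laguerrePoly_half_sq_coeff_rec (m l : ℕ) :
    2 * ((l : ℝ) + 2) ^ 3 * (laguerrePoly (1 / 2) m ^ 2).coeff (l + 2)
      + (-3 * ((l : ℝ) + 1) * l - 4 * ((l : ℝ) + 1) + 4 * m * ((l : ℝ) + 1) + 2 * m)
        * (laguerrePoly (1 / 2) m ^ 2).coeff (l + 1)
      + ((l : ℝ) - 2 * m) * (laguerrePoly (1 / 2) m ^ 2).coeff l = 0 := by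
  have h := congrArg (fun p => p.coeff (l + 1)) (laguerrePoly_half_sq_ode m _ rfl)
  generalize laguerrePoly (1 / 2) m ^ 2 = w at *
  simp only [show (2 : ℝ[X]) = C 2 from rfl, show (6 : ℝ[X]) = C 6 from rfl,
    show (3 : ℝ[X]) = C 3 from rfl, coeff_add, coeff_sub, coeff_C_mul, coeff_X_mul,
    coeff_derivative, coeff_zero] at h
  rcases l with _ | l
  · simp only [coeff_X_mul_zero] at h
    push_cast at h ⊢
    norm_num at h ⊢
    linear_combination h
  · simp only [coeff_X_mul, coeff_derivative] at h
    push_cast at h ⊢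
    linear_combination h

end LaguerrePoly

lemma arcsineWeight_succ {m j : ℕ} (h : j < m) :
    arcsineWeight m (j + 1) * ((2 * j + 2) * (2 * m - 2 * j - 1))
      = arcsineWeight m j * ((2 * j + 1) * (2 * m - 2 * j)) := by
  obtain ⟨i, rfl⟩ := Nat.exists_eq_add_of_lt h
  have e1 : j + i + 1 - (j + 1) = i := by omega
  have e2 : j + i + 1 - j = i + 1 := by omega
  have h1 : ((j : ℝ) + 1) * (j + 1).centralBinom = 2 * (2 * j + 1) * j.centralBinom := by
    exact_mod_cast Nat.succ_mul_centralBinom_succ j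
  have h2 : ((i : ℝ) + 1) * (i + 1).centralBinom = 2 * (2 * i + 1) * i.centralBinom := by
    exact_mod_cast Nat.succ_mul_centralBinom_succ i
  rw [arcsineWeight, arcsineWeight, e1, e2]
  push_cast
  field_simp
  linear_combination (i.centralBinom : ℝ) * (2 * i + 1) * h1
    - (j.centralBinom : ℝ) * (2 * j + 1) * h2

lemma arcsineMoment_rec (m l : ℕ) :
    2 * ((l : ℝ) + 2) ^ 2 * arcsineMoment m (l + 2)
      + (3 * ((l : ℝ) + 1) ^ 2 + (l + 1) - 4 * m * (l + 1) - 2 * m) * arcsineMoment m (l + 1)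
      + ((l : ℝ) + 1) * (l - 2 * m) * arcsineMoment m l = 0 := by
  have telescope :
      ∑ j ∈ Finset.range (m + 1), arcsineWeight m j * ((2 * j + 1) * (2 * m - 2 * j))
          * ((2 * j + 1).choose (l + 1) : ℝ)
        = ∑ j ∈ Finset.range (m + 1), arcsineWeight m j * (2 * m + 1 - 2 * j)
          * ((l + 2) * ((2 * j).choose (l + 2) : ℝ)) := by
    rw [Finset.sum_range_succ, Finset.sum_range_succ']
    simp only [sub_self, mul_zero, zero_mul, add_zero, Nat.choose_zero_succ, Nat.cast_zero]
    refine Finset.sum_congr rfl fun j hj => ?_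
    have hw := arcsineWeight_succ (Finset.mem_range.1 hj)
    have hc : ((2 * j + 2 : ℕ) : ℝ) * ((2 * j + 1).choose (l + 1) : ℝ)
        = ((2 * (j + 1)).choose (l + 2) : ℝ) * ((l + 2 : ℕ) : ℝ) := by
      exact_mod_cast Nat.add_one_mul_choose_eq (2 * j + 1) (l + 1)
    push_cast at hc ⊢
    linear_combination -((2 * j + 1).choose (l + 1) : ℝ) * hw
      + arcsineWeight m (j + 1) * (2 * m - 2 * j - 1) * hc
  rw [← sub_eq_zero, ← Finset.sum_sub_distrib] at telescope
  rw [← neg_eq_zero, ← telescope]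
  simp only [arcsineMoment, Finset.mul_sum, ← Finset.sum_add_distrib, ← Finset.sum_neg_distrib]
  refine Finset.sum_congr rfl fun j _ => ?_
  have h1 := cast_choose_succ_mul (2 * j) l
  have h2 := cast_choose_succ_mul (2 * j) (l + 1)
  rw [Nat.choose_succ_succ' (2 * j) l]
  push_cast at h1 h2 ⊢
  generalize ((2 * j).choose l : ℝ) = a at *
  generalize ((2 * j).choose (l + 1) : ℝ) = b at *
  generalize ((2 * j).choose (l + 2) : ℝ) = c at *
  linear_combination arcsineWeight m j
    * ((2 * m - 2 * j - l - 1) * h1 + (2 * m - 2 * j - 2 * l - 3) * h2)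

lemma arcsineMoment_top (m : ℕ) : arcsineMoment m (2 * m) = (m.centralBinom : ℝ) / 4 ^ m := by
  rw [arcsineMoment, Finset.sum_range_succ, Finset.sum_eq_zero]
  · simp [arcsineWeight]
  · intro j hj
    rw [Nat.choose_eq_zero_of_lt (by have := Finset.mem_range.1 hj; omega)]
    simp

lemma arcsineMoment_eq_zero {m l : ℕ} (h : 2 * m < l) : arcsineMoment m l = 0 := by
  refine Finset.sum_eq_zero fun j hj => ?_
  rw [Nat.choose_eq_zero_of_lt (by have := Finset.mem_range.1 hj; omega)]
  simp

section SquareExpansion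

open Polynomial

lemma laguerrePoly_half_sq_coeff (m l : ℕ) :
    (laguerrePoly (1 / 2) m ^ 2).coeff l
      = (-1) ^ l / (l.factorial : ℝ) * arcsineMoment m l := by
  have hdeg : (laguerrePoly (1 / 2) m ^ 2).natDegree ≤ 2 * m :=
    natDegree_pow_le_of_le 2 (laguerrePoly_natDegree_le _ m)
  have above : ∀ l, 2 * m < l → (laguerrePoly (1 / 2) m ^ 2).coeff l
      = (-1) ^ l / (l.factorial : ℝ) * arcsineMoment m l := fun l hl => by
    rw [arcsineMoment_eq_zero hl, coeff_eq_zero_of_natDegree_lt (by omega), mul_zero]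
  have below : ∀ i l, l + i = 2 * m →
      ((laguerrePoly (1 / 2) m ^ 2).coeff l
        = (-1) ^ l / (l.factorial : ℝ) * arcsineMoment m l) ∧
      ((laguerrePoly (1 / 2) m ^ 2).coeff (l + 1)
        = (-1) ^ (l + 1) / ((l + 1).factorial : ℝ) * arcsineMoment m (l + 1)) := by
    intro i
    induction i with
    | zero =>
      rintro l rfl
      refine ⟨?_, above _ (by omega)⟩
      rw [coeff_pow_of_natDegree_le (laguerrePoly_natDegree_le _ m), laguerrePoly_coeff,
        arcsineMoment_top, Nat.centralBinom, Nat.cast_choose ℝ (by omega : m ≤ 2 * m),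
        show 2 * m - m = m by omega, Nat.choose_self, pow_mul, show (4 : ℝ) = 2 ^ 2 by norm_num,
        neg_one_sq, one_pow, ← pow_mul, mul_comm 2 m, pow_mul 2 m 2]
      have hhalf : ((-(1 / 2) : ℝ) ^ m) ^ 2 * (2 ^ m) ^ 2 = 1 := by
        rw [← mul_pow, ← mul_pow, ← pow_mul, mul_comm m 2, pow_mul]
        norm_num
      have : ((m * 2).factorial : ℝ) ≠ 0 := by positivity
      generalize (-(1 / 2) : ℝ) ^ m = r at *
      field_simp
      push_cast
      linear_combination hhalf
    | succ i ih =>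
      intro l hl
      obtain ⟨h1, h2⟩ := ih (l + 1) (by omega)
      refine ⟨?_, h1⟩
      have hne : (l : ℝ) - 2 * m ≠ 0 := by
        have : (l : ℝ) + (i + 1) = 2 * m := by exact_mod_cast hl
        have : (0 : ℝ) ≤ i := by positivity
        intro h; linarith
      have r1 := laguerrePoly_half_sq_coeff_rec m l
      have r2 := arcsineMoment_rec m l
      rw [h1, h2] at r1
      generalize (laguerrePoly (1 / 2) m ^ 2).coeff l = a at *
      simp only [Nat.factorial_succ, pow_succ] at r1 ⊢
      push_cast at r1 ⊢
      have : (l.factorial : ℝ) ≠ 0 := by positivity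
      field_simp at r1 ⊢
      refine mul_left_cancel₀
        (mul_ne_zero hne (by positivity : ((l : ℝ) + 1) * (l + 2) ≠ 0)) ?_
      linear_combination r1 - (-1) ^ l * ((l : ℝ) + 2) * r2
  rcases le_or_gt l (2 * m) with h | h
  · exact (below (2 * m - l) l (by omega)).1
  · exact above l h

/-- The expansion of `L_m(x/2)^2` in Laguerre polynomials of even degree. -/
lemma laguerrePoly_half_sq (m : ℕ) :
    laguerrePoly (1 / 2) m ^ 2
      = ∑ j ∈ Finset.range (m + 1), C (arcsineWeight m j) * laguerrePoly 1 (2 * j) := by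
  ext l
  rw [laguerrePoly_half_sq_coeff, arcsineMoment, Finset.mul_sum, finsetSum_coeff]
  refine Finset.sum_congr rfl fun j _ => ?_
  rw [coeff_C_mul, laguerrePoly_coeff]
  ring

lemma sum_arcsineWeight (m : ℕ) : ∑ j ∈ Finset.range (m + 1), arcsineWeight m j = 1 := by
  have h := congrArg (eval 0) (laguerrePoly_half_sq m)
  simpa [eval_finsetSum, laguerrePoly_eval_zero] using h.symm

lemma sum_arcsineWeight_mul_laguerreL (m : ℕ) (x : ℝ) :
    ∑ j ∈ Finset.range (m + 1), arcsineWeight m j * laguerreL (2 * j) x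
      = (laguerrePoly (1 / 2) m).eval x ^ 2 := by
  have h := congrArg (eval x) (laguerrePoly_half_sq m)
  simpa [eval_finsetSum, laguerrePoly_one_eval] using h.symm

lemma sum_arcsineWeight_odd_poly (m : ℕ) :
    ∑ j ∈ Finset.range (m + 1), C (arcsineWeight m j)
        * (C (2 * m + 1 - 2 * j : ℝ) * laguerrePoly 1 (2 * j)
          - C (2 * j + 1 : ℝ) * laguerrePoly 1 (2 * j + 1))
      = X * (laguerrePoly (1 / 2) m - 2 * derivative (laguerrePoly (1 / 2) m)) ^ 2 := by
  set w := laguerrePoly (1 / 2) m ^ 2 with hw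
  have expand : ∑ j ∈ Finset.range (m + 1), C (arcsineWeight m j)
        * (C (2 * m + 1 - 2 * j : ℝ) * laguerrePoly 1 (2 * j)
          - C (2 * j + 1 : ℝ) * laguerrePoly 1 (2 * j + 1))
      = 2 * X * derivative (derivative w) + (2 - 3 * X) * derivative w
        + (C (2 * m : ℝ) + X) * w := by
    rw [hw, laguerrePoly_half_sq]
    simp only [derivative_sum, derivative_C_mul, Finset.mul_sum, ← Finset.sum_add_distrib]
    refine Finset.sum_congr rfl fun j _ => ?_
    have h1 := laguerrePoly_ode 1 (2 * j)
    have h2 := laguerrePoly_succ (2 * j)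
    push_cast at h1 h2
    simp only [C_mul, C_add, C_sub, C_1, one_mul] at h1 h2 ⊢
    simp only [show C (2 : ℝ) = 2 from rfl] at h1 h2 ⊢
    linear_combination -C (arcsineWeight m j) * h2 - 2 * C (arcsineWeight m j) * h1
  rw [expand, hw]
  have h := laguerrePoly_ode (1 / 2) m
  have hc : C ((1 : ℝ) / 2) * 2 = 1 := by
    rw [show (2 : ℝ[X]) = C 2 from rfl, ← C_mul]; norm_num
  simp only [pow_two, derivative_mul, derivative_add, C_mul, show C (2 : ℝ) = 2 from rfl] at h ⊢
  generalize derivative (derivative (laguerrePoly (1 / 2) m)) = y2 at *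
  generalize derivative (laguerrePoly (1 / 2) m) = y1 at *
  generalize laguerrePoly (1 / 2) m = y at *
  generalize C ((1 : ℝ) / 2) = c at *
  generalize C (m : ℝ) = M at *
  linear_combination 4 * y * h + (2 * y * X * y1 - 2 * M * y ^ 2) * hc

lemma sum_arcsineWeight_odd (m : ℕ) (x : ℝ) :
    ∑ j ∈ Finset.range (m + 1), arcsineWeight m j
        * ((2 * m + 1 - 2 * j) * laguerreL (2 * j) x - (2 * j + 1) * laguerreL (2 * j + 1) x)
      = x * ((laguerrePoly (1 / 2) m).eval x
          - 2 * (derivative (laguerrePoly (1 / 2) m)).eval x) ^ 2 := by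
  have h := congrArg (eval x) (sum_arcsineWeight_odd_poly m)
  simpa only [eval_finsetSum, eval_mul, eval_sub, eval_C, eval_X, eval_pow, eval_ofNat,
    laguerrePoly_one_eval] using h

end SquareExpansion

lemma Fseq_nonneg (n k : ℕ) : 0 ≤ Fseq n k := by
  unfold Fseq
  split_ifs <;> positivity

lemma Fseq_eq_zero {n k : ℕ} (h : n < k) : Fseq n k = 0 := by
  have : ¬ k ≤ n := by omega
  simp [Fseq, this]

lemma Fseq_even_even {m j : ℕ} (h : j ≤ m) : Fseq (2 * m) (2 * j) = arcsineWeight m j := by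
  have e1 : 2 * m - 2 * j = 2 * (m - j) := by omega
  simp [Fseq, arcsineWeight, Nat.centralBinom, e1, h, pow_mul]
  norm_num

lemma Fseq_even_odd (m j : ℕ) : Fseq (2 * m) (2 * j + 1) = 0 := by
  simp [Fseq]

lemma Fseq_odd_even {m j : ℕ} (h : j ≤ m) :
    Fseq (2 * m + 1) (2 * j) = arcsineWeight m j * (2 * m + 1 - 2 * j) / (2 * (m + 1)) := by
  obtain ⟨i, rfl⟩ := Nat.exists_eq_add_of_le h
  have e1 : (2 * (j + i) + 1) % 2 ≠ 0 := by omega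
  have e2 : (2 * (j + i) + 1) / 2 = j + i := by omega
  have e3 : 2 * j ≤ 2 * (j + i) + 1 := by omega
  have e4 : 2 * (j + i) + 1 - (j + i) = j + i + 1 := by omega
  have e5 : 2 * (j + i) + 1 - 2 * j = 2 * i + 1 := by omega
  have e6 : j + i ≤ 2 * (j + i) + 1 := by omega
  have e7 : 2 * j / 2 = j := by omega
  simp only [Fseq, arcsineWeight, if_neg e1, if_pos e3, e2, e7, Nat.centralBinom,
    Nat.cast_choose ℝ e6, Nat.cast_choose ℝ e3, Nat.cast_choose ℝ h, e4, e5,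
    Nat.cast_choose ℝ (by omega : j ≤ 2 * j), Nat.cast_choose ℝ (by omega : i ≤ 2 * i),
    Nat.add_sub_cancel_left, show 2 * j - j = j by omega, show 2 * i - i = i by omega,
    Nat.factorial_succ, show (4 : ℝ) = 2 ^ 2 by norm_num, ← pow_mul]
  push_cast
  field_simp
  ring

lemma Fseq_odd_odd {m j : ℕ} (h : j ≤ m) :
    Fseq (2 * m + 1) (2 * j + 1) = arcsineWeight m j * (2 * j + 1) / (2 * (m + 1)) := by
  have hc : ((2 * m + 1).choose (2 * j + 1) : ℝ) * (2 * j + 1)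
      = (2 * m + 1).choose (2 * j) * (2 * m + 1 - 2 * j) := by
    exact_mod_cast cast_choose_succ_mul (2 * m + 1) (2 * j)
  have h1 : (0 : ℝ) < (2 * m + 1).choose (2 * j) := by
    exact_mod_cast Nat.choose_pos (by omega)
  have h2 : (0 : ℝ) < (2 * m + 1).choose (2 * j + 1) := by
    exact_mod_cast Nat.choose_pos (by omega)
  have hF := Fseq_odd_even h
  have e1 : (2 * m + 1) % 2 ≠ 0 := by omega
  have e2 : 2 * j ≤ 2 * m + 1 := by omega
  have e3 : 2 * j + 1 ≤ 2 * m + 1 := by omega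
  have e4 : 2 * j / 2 = j := by omega
  have e5 : (2 * j + 1) / 2 = j := by omega
  simp only [Fseq, if_neg e1, if_pos e2, if_pos e3, e4, e5] at hF ⊢
  field_simp at hF ⊢
  linear_combination hF - 2 ^ (2 * m + 1) * arcsineWeight m j * hc

lemma sum_range_two_mul_add_two (f : ℕ → ℝ) (m : ℕ) :
    ∑ k ∈ Finset.range (2 * m + 1 + 1), f k
      = ∑ j ∈ Finset.range (m + 1), (f (2 * j) + f (2 * j + 1)) := by
  induction m with
  | zero => simp [Finset.sum_range_succ]
  | succ m ih =>
    rw [Finset.sum_range_succ _ (m + 1), ← ih, show 2 * (m + 1) = 2 * m + 1 + 1 by ring,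
      Finset.sum_range_succ _ (2 * m + 1 + 1 + 1), Finset.sum_range_succ _ (2 * m + 1 + 1),
      add_assoc]

lemma sum_Fseq_even_mul (m : ℕ) (g : ℕ → ℝ) :
    ∑ k ∈ Finset.range (2 * m + 1), Fseq (2 * m) k * g k
      = ∑ j ∈ Finset.range (m + 1), arcsineWeight m j * g (2 * j) := by
  have h := sum_range_two_mul_add_two (fun k => Fseq (2 * m) k * g k) m
  rw [Finset.sum_range_succ, Fseq_even_odd, zero_mul, add_zero] at h
  rw [h]
  refine Finset.sum_congr rfl fun j hj => ?_
  rw [Fseq_even_even (Finset.mem_range_succ_iff.1 hj), Fseq_even_odd]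
  ring

lemma sum_Fseq_odd_mul (m : ℕ) (g : ℕ → ℝ) :
    ∑ k ∈ Finset.range (2 * m + 1 + 1), Fseq (2 * m + 1) k * g k
      = (∑ j ∈ Finset.range (m + 1), arcsineWeight m j
        * ((2 * m + 1 - 2 * j) * g (2 * j) + (2 * j + 1) * g (2 * j + 1))) / (2 * (m + 1)) := by
  rw [sum_range_two_mul_add_two, Finset.sum_div]
  refine Finset.sum_congr rfl fun j hj => ?_
  have hj' := Finset.mem_range_succ_iff.1 hj
  rw [Fseq_odd_even hj', Fseq_odd_odd hj']
  ring

lemma sum_Fseq (n : ℕ) : ∑ k ∈ Finset.range (n + 1), Fseq n k = 1 := by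
  have hone : ∀ k, Fseq n k = Fseq n k * (fun _ => (1 : ℝ)) k := fun k => (mul_one _).symm
  rw [Finset.sum_congr rfl fun k _ => hone k]
  rcases Nat.even_or_odd' n with ⟨m, rfl | rfl⟩
  · rw [sum_Fseq_even_mul]
    simpa using sum_arcsineWeight m
  · rw [sum_Fseq_odd_mul, div_eq_one_iff_eq (by positivity)]
    have h : ∀ j : ℕ, arcsineWeight m j * ((2 * m + 1 - 2 * j) * 1 + (2 * j + 1) * 1)
        = arcsineWeight m j * (2 * (m + 1)) := fun j => by ring
    simp only [h]
    rw [← Finset.sum_mul, sum_arcsineWeight, one_mul]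

lemma sum_Fseq_mul_laguerreFun_nonneg (n : ℕ) {x : ℝ} (hx : 0 ≤ x) :
    0 ≤ ∑ k ∈ Finset.range (n + 1), Fseq n k * laguerreFun k x := by
  have hsplit : ∀ k, Fseq n k * laguerreFun k x
      = Fseq n k * (fun i => (-1) ^ i * laguerreL i x) k * Real.exp (-x / 2) := fun k => by
    simp only [laguerreFun]; ring
  rw [Finset.sum_congr rfl fun k _ => hsplit k, ← Finset.sum_mul]
  refine mul_nonneg ?_ (Real.exp_pos _).le
  rcases Nat.even_or_odd' n with ⟨m, rfl | rfl⟩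
  · rw [sum_Fseq_even_mul]
    simp only [pow_mul, neg_one_sq, one_pow, one_mul]
    rw [sum_arcsineWeight_mul_laguerreL]
    positivity
  · rw [sum_Fseq_odd_mul]
    simp only [pow_add, pow_one, pow_mul, neg_one_sq, one_pow, one_mul, neg_mul, mul_neg,
      ← sub_eq_add_neg]
    rw [sum_arcsineWeight_odd]
    positivity

lemma Fseq_self (n : ℕ) : Fseq n n = (n.choose (n / 2) : ℝ) / 2 ^ n := by
  unfold Fseq
  split_ifs with h1 h2 h2 <;> simp_all

lemma Fseq_self_le_lpVal (n : ℕ) : Fseq n n ≤ lpVal n := by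
  refine le_csSup ⟨1, ?_⟩ ⟨Fseq n, Fseq_nonneg n, ?_, fun x hx => ?_, rfl⟩
  · rintro v ⟨F, hF, hsum, -, rfl⟩
    have hs : Summable F := by
      by_contra h
      rw [tsum_eq_zero_of_not_summable h] at hsum
      exact zero_ne_one hsum
    exact hsum ▸ hs.le_tsum n fun k _ => hF k
  · rw [tsum_eq_sum (s := Finset.range (n + 1)), sum_Fseq]
    intro k hk
    exact Fseq_eq_zero (by simpa using hk)
  · rw [tsum_eq_sum (s := Finset.range (n + 1))]
    · exact sum_Fseq_mul_laguerreFun_nonneg n hx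
    · intro k hk
      rw [Fseq_eq_zero (by simpa using hk), zero_mul]

lemma one_div_le_choose_middle_div (n : ℕ) :
    1 / ((n : ℝ) + 1) ≤ (n.choose (n / 2) : ℝ) / 2 ^ n := by
  rw [div_le_div_iff₀ (by positivity) (by positivity), one_mul]
  have h : 2 ^ n ≤ (n + 1) * n.choose (n / 2) := by
    rw [← Nat.sum_range_choose n]
    simpa using Finset.sum_le_card_nsmul (Finset.range (n + 1)) (fun k => n.choose k) _
      fun k _ => Nat.choose_le_middle k n
  rw [mul_comm]
  exact_mod_cast h

/-- for `n ≥ 1`, the sequence `F^n` is a feasible solution of `(LP^{L²}_n)`,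
hence `ω_n^{L²} ≥ F_n^n = 2^{-n} C(n, ⌊n/2⌋) ≥ 1/(n+1)`. -/
theorem Fseq_feasible_and_lower_bound (n : ℕ) (hn : 1 ≤ n) :
    (∀ k, 0 ≤ Fseq n k) ∧
    (∑ k ∈ Finset.range (n + 1), Fseq n k) = 1 ∧
    (∀ x : ℝ, 0 ≤ x → 0 ≤ ∑ k ∈ Finset.range (n + 1), Fseq n k * laguerreFun k x) ∧
    Fseq n n = (n.choose (n / 2) : ℝ) / 2 ^ n ∧
    (n.choose (n / 2) : ℝ) / 2 ^ n ≤ lpVal n ∧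
    1 / ((n : ℝ) + 1) ≤ (n.choose (n / 2) : ℝ) / 2 ^ n :=
  ⟨Fseq_nonneg n, sum_Fseq n, fun _ hx => sum_Fseq_mul_laguerreFun_nonneg n hx, Fseq_self n,
    Fseq_self n ▸ Fseq_self_le_lpVal n, one_div_le_choose_middle_div n⟩
end

section
/- For every integer n ≥ 1, the optimal value of the semidefinite program (SDP^{n,≤}_n) (the level m = n of the hierarchy of restrictions) equals 2^{−n} · C(n, ⌊n/2⌋): the supremum of F_n over all feasible pairs (Q, F) equals 2^{−n} · C(n, ⌊n/2⌋). -/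
/-- `ω_n^{m,≤}`: the optimal value of the semidefinite restriction `(SDP^{m,≤}_n)`. -/
noncomputable def sdpRestrVal (n m : ℕ) : ℝ :=
  sSup {v : ℝ | ∃ (Q : Matrix (Fin (m + 1)) (Fin (m + 1)) ℝ) (F : ℕ → ℝ),
    Q.PosSemidef ∧
    (∑ k ∈ Finset.range (m + 1), F k) = 1 ∧
    (∀ k ≤ m, 0 ≤ F k) ∧
    (∀ l, 1 ≤ l → l ≤ m →
      (∑ i : Fin (m + 1), ∑ j : Fin (m + 1),
        if i.val + j.val = 2 * l - 1 then Q i j else 0) = 0) ∧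
    (∀ l ≤ m,
      (∑ i : Fin (m + 1), ∑ j : Fin (m + 1),
        if i.val + j.val = 2 * l then Q i j else 0)
      = ∑ k ∈ Finset.Icc l m,
          ((-1 : ℝ) ^ (k + l) / (l.factorial : ℝ)) * (k.choose l : ℝ) * F k) ∧
    v = F n}

open Polynomial Finset

lemma coeff_even_even (m : ℕ) : ∀ j : ℕ,
    ((X + 1 : ℝ[X]) ^ (2 * j) * (X - 1) ^ (2 * m)).coeff (j + m) =
      (-1 : ℝ) ^ m * (((2 * j).factorial : ℝ) * (2 * m).factorial /
        (j.factorial * m.factorial * (j + m).factorial)) := by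
  induction m with
  | zero =>
    intro j
    have h := Nat.add_choose_mul_factorial_mul_factorial j j
    have h' : ((j + j).choose j : ℝ) * j.factorial * j.factorial = (j + j).factorial := by
      exact_mod_cast h
    simp only [mul_zero, pow_zero, mul_one, add_zero, coeff_X_add_one_pow, two_mul,
      Nat.factorial_zero, Nat.cast_one, one_mul]
    rw [← h']
    field_simp
  | succ m ih =>
    intro j
    have e : (X + 1 : ℝ[X]) ^ (2 * j) * (X - 1) ^ (2 * (m + 1)) =
        (X + 1) ^ (2 * (j + 1)) * (X - 1) ^ (2 * m) -
          C 4 * ((X + 1) ^ (2 * j) * (X - 1) ^ (2 * m) * X) := by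
      rw [show (C 4 : ℝ[X]) = 4 from rfl]
      ring
    have h1 := ih (j + 1)
    rw [show j + 1 + m = j + m + 1 by ring] at h1
    rw [e, coeff_sub, coeff_C_mul, ← add_assoc, coeff_mul_X, h1, ih j]
    simp only [show ∀ i, 2 * (i + 1) = 2 * i + 1 + 1 from fun i => by ring, Nat.factorial_succ]
    push_cast
    field_simp
    ring

lemma coeff_odd_even (m : ℕ) : ∀ j : ℕ,
    ((X + 1 : ℝ[X]) ^ (2 * j + 1) * (X - 1) ^ (2 * m)).coeff (j + m + 1) =
      (-1 : ℝ) ^ m * (((2 * j + 1).factorial : ℝ) * (2 * m).factorial /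
        (j.factorial * m.factorial * (j + m + 1).factorial)) := by
  induction m with
  | zero =>
    intro j
    have h := Nat.add_choose_mul_factorial_mul_factorial j (j + 1)
    have h' : ((2 * j + 1).choose (j + 1) : ℝ) * j.factorial * (j + 1).factorial
        = (2 * j + 1).factorial := by
      rw [show 2 * j + 1 = j + (j + 1) by ring]
      exact_mod_cast h
    simp only [mul_zero, pow_zero, mul_one, add_zero, coeff_X_add_one_pow,
      Nat.factorial_zero, Nat.cast_one, one_mul]
    rw [← h']
    field_simp
  | succ m ih =>
    intro j
    have e : (X + 1 : ℝ[X]) ^ (2 * j + 1) * (X - 1) ^ (2 * (m + 1)) =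
        (X + 1) ^ (2 * (j + 1) + 1) * (X - 1) ^ (2 * m) -
          C 4 * ((X + 1) ^ (2 * j + 1) * (X - 1) ^ (2 * m) * X) := by
      rw [show (C 4 : ℝ[X]) = 4 from rfl]
      ring
    have h1 := ih (j + 1)
    rw [show j + 1 + m + 1 = j + m + 1 + 1 by ring] at h1
    rw [e, coeff_sub, coeff_C_mul, ← add_assoc, coeff_mul_X, h1, ih j]
    simp only [show ∀ i, 2 * (i + 1) = 2 * i + 1 + 1 from fun i => by ring, Nat.factorial_succ]
    push_cast
    field_simp
    ring

lemma coeff_even_odd (m : ℕ) : ∀ j : ℕ,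
    ((X + 1 : ℝ[X]) ^ (2 * j) * (X - 1) ^ (2 * m + 1)).coeff (j + m + 1) =
      (-1 : ℝ) ^ m * (((2 * j).factorial : ℝ) * (2 * m + 1).factorial /
        (j.factorial * m.factorial * (j + m + 1).factorial)) := by
  induction m with
  | zero =>
    intro j
    have h := Nat.add_choose_mul_factorial_mul_factorial j j
    have h' : ((2 * j).choose j : ℝ) * j.factorial * j.factorial = (2 * j).factorial := by
      rw [two_mul]; exact_mod_cast h
    have h2 := Nat.choose_succ_right_eq (2 * j) j
    rw [show 2 * j - j = j by omega] at h2
    have h3 : ((2 * j).choose (j + 1) : ℝ) = (2 * j).choose j * j / (j + 1) := by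
      rw [eq_div_iff (by positivity)]; exact_mod_cast h2
    simp only [mul_zero, pow_zero, mul_one, add_zero, zero_add, pow_one, mul_sub, coeff_sub,
      coeff_mul_X, coeff_X_add_one_pow, Nat.factorial_zero, Nat.factorial_one, Nat.cast_one,
      one_mul]
    rw [h3, ← h', Nat.factorial_succ]
    push_cast
    field_simp
    ring
  | succ m ih =>
    intro j
    have e : (X + 1 : ℝ[X]) ^ (2 * j) * (X - 1) ^ (2 * (m + 1) + 1) =
        (X + 1) ^ (2 * (j + 1)) * (X - 1) ^ (2 * m + 1) -
          C 4 * ((X + 1) ^ (2 * j) * (X - 1) ^ (2 * m + 1) * X) := by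
      rw [show (C 4 : ℝ[X]) = 4 from rfl]
      ring
    have h1 := ih (j + 1)
    rw [show j + 1 + m + 1 = j + m + 1 + 1 by ring] at h1
    rw [e, coeff_sub, coeff_C_mul, ← add_assoc, coeff_mul_X, h1, ih j]
    simp only [show ∀ i, 2 * (i + 1) = 2 * i + 1 + 1 from fun i => by ring, Nat.factorial_succ]
    push_cast
    field_simp
    ring

/-- Expansion of the twisted product in powers of `σ`. -/
lemma coeff_twist (p e : ℕ) (σ : ℝ) :
    ((X + C σ * (X + 1)) ^ p * (1 + C σ * (X + 1)) ^ (p + e)).coeff (p + e) =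
      ∑ a ∈ range (p + 1), ∑ b ∈ range (p + e + 1),
        (p.choose a : ℝ) * (p + e).choose b * σ ^ (a + b) * (a + b).choose (a + e) := by
  rw [add_comm X, add_comm 1 (C σ * (X + 1)), add_pow, add_pow, sum_mul_sum, finsetSum_coeff]
  refine sum_congr rfl fun a ha => ?_
  rw [finsetSum_coeff]
  refine sum_congr rfl fun b _ => ?_
  have ha' : a ≤ p := by simpa [Nat.lt_succ_iff] using ha
  have h : (C σ * (X + 1)) ^ a * X ^ (p - a) * (p.choose a : ℝ[X]) *
      ((C σ * (X + 1)) ^ b * 1 ^ (p + e - b) * ((p + e).choose b : ℝ[X])) =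
      C ((p.choose a : ℝ) * (p + e).choose b * σ ^ (a + b)) *
        ((X + 1) ^ (a + b) * X ^ (p - a)) := by
    simp only [C_mul, C_pow, map_natCast, mul_pow]
    ring
  rw [h, coeff_C_mul, coeff_mul_X_pow', if_pos (by omega), coeff_X_add_one_pow,
    show p + e - (p - a) = a + e by omega]

lemma twist_eq (p e : ℕ) (w : ℝ) :
    (X + C (-(1 + w) / 2) * (X + 1)) ^ p * (1 + C (-(1 + w) / 2) * (X + 1)) ^ (p + e) =
      C ((-1) ^ (p + e) / 2 ^ (2 * p + e)) *
        (∑ j ∈ range (p + 1), C ((p.choose j : ℝ) * (-1) ^ j * w ^ (2 * j)) *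
          ((X + 1) ^ (2 * j) * (X - 1) ^ (2 * (p - j)))) * ((X - 1) + C w * (X + 1)) ^ e := by
  have h1 : (X + C (-(1 + w) / 2) * (X + 1) : ℝ[X]) =
      C (1 / 2) * ((X - 1) - C w * (X + 1)) := by
    have : (C (1/2) : ℝ[X]) * 2 = 1 := by rw [← C_ofNat, ← C_mul]; norm_num
    rw [show -(1 + w) / 2 = -(1 + w) * (1 / 2) by ring, C_mul, C_neg, C_add, C_1]
    linear_combination (-X : ℝ[X]) * this
  have h2 : (1 + C (-(1 + w) / 2) * (X + 1) : ℝ[X]) =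
      C (-1 / 2) * ((X - 1) + C w * (X + 1)) := by
    have : (C (1/2) : ℝ[X]) * 2 = 1 := by rw [← C_ofNat, ← C_mul]; norm_num
    rw [show -(1 + w) / 2 = -(1 + w) * (1 / 2) by ring, show (-1 / 2 : ℝ) = - (1 / 2) by ring,
      C_mul, C_neg, C_neg, C_add, C_1]
    linear_combination (-1 : ℝ[X]) * this
  have h3 : (∑ j ∈ range (p + 1), C ((p.choose j : ℝ) * (-1) ^ j * w ^ (2 * j)) *
      ((X + 1) ^ (2 * j) * (X - 1) ^ (2 * (p - j))) : ℝ[X]) =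
      ((X - 1) - C w * (X + 1)) ^ p * ((X - 1) + C w * (X + 1)) ^ p := by
    rw [← mul_pow, show ((X - 1) - C w * (X + 1) : ℝ[X]) * ((X - 1) + C w * (X + 1)) =
      -(C w * (X + 1)) ^ 2 + (X - 1) ^ 2 by ring, add_pow]
    refine sum_congr rfl fun j _ => ?_
    simp only [C_mul, C_pow, map_natCast, C_neg, C_1]
    rw [neg_pow ((C w * (X + 1)) ^ 2), mul_pow, mul_pow, ← pow_mul, ← pow_mul, ← pow_mul]
    ring
  rw [h3, h1, h2, mul_pow, mul_pow,
    show ((-1) ^ (p + e) / 2 ^ (2 * p + e) : ℝ) = (1 / 2) ^ p * (-1 / 2) ^ (p + e) by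
      rw [div_pow, div_pow]; field_simp; ring, C_mul, C_pow, C_pow]
  ring

lemma neg_one_pow_mul_sub {p j : ℕ} (h : j ≤ p) :
    (-1 : ℝ) ^ p * (-1) ^ j * (-1) ^ (p - j) = 1 := by
  rw [mul_assoc, ← pow_add, show j + (p - j) = p by omega, ← pow_add, Even.neg_one_pow ⟨p, rfl⟩]

/-- The twisted coefficient, as a polynomial in `w`, has nonnegative coefficients. -/
lemma exists_nonneg_poly (p e : ℕ) (he : e ≤ 1) : ∃ P : ℝ[X], (∀ k, 0 ≤ P.coeff k) ∧
    P.natDegree ≤ 2 * p + e ∧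
    P.coeff (2 * p + e) = ((2 * p + e).choose p : ℝ) / 2 ^ (2 * p + e) ∧
    ∀ w : ℝ, P.eval w = (-1) ^ e * ((X + C (-(1 + w) / 2) * (X + 1)) ^ p *
      (1 + C (-(1 + w) / 2) * (X + 1)) ^ (p + e)).coeff (p + e) := by
  obtain rfl | rfl : e = 0 ∨ e = 1 := by omega
  · refine ⟨∑ j ∈ range (p + 1), C (((2 * j).factorial * (2 * (p - j)).factorial /
        (j.factorial * (p - j).factorial * p.factorial) : ℝ) * p.choose j / 2 ^ (2 * p)) *
          X ^ (2 * j), fun k => ?_, ?_, ?_, fun w => ?_⟩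
    · rw [finsetSum_coeff]
      refine sum_nonneg fun j _ => ?_
      rw [coeff_C_mul, coeff_X_pow]
      split_ifs <;> positivity
    · refine natDegree_sum_le_of_forall_le _ _ fun j hj => ?_
      refine (natDegree_C_mul_X_pow_le _ _).trans ?_
      have := mem_range.1 hj
      omega
    · rw [finsetSum_coeff, sum_eq_single_of_mem p (by simp)]
      · have h : ((2 * p).choose p : ℝ) * p.factorial * p.factorial = (2 * p).factorial := by
          rw [two_mul]; exact_mod_cast Nat.add_choose_mul_factorial_mul_factorial p p
        simp only [add_zero, coeff_C_mul, coeff_X_pow, if_true, Nat.sub_self, mul_zero,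
          Nat.factorial_zero, Nat.cast_one, Nat.choose_self]
        rw [← h]
        field_simp
      · intro j _ hj
        rw [coeff_C_mul, coeff_X_pow, if_neg (by omega), mul_zero]
    · rw [twist_eq, pow_zero, pow_zero, mul_one, coeff_C_mul, finsetSum_coeff, eval_finsetSum,
        one_mul, mul_sum]
      refine sum_congr rfl fun j hj => ?_
      have hj' : j ≤ p := by have := mem_range.1 hj; omega
      have h := coeff_even_even (p - j) j
      rw [show j + (p - j) = p by omega] at h
      rw [coeff_C_mul, add_zero, h]
      simp only [eval_mul, eval_C, eval_pow, eval_X, add_zero]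
      linear_combination (-w ^ (2 * j) * ((2 * j).factorial * (2 * (p - j)).factorial /
        (j.factorial * (p - j).factorial * p.factorial) : ℝ) * p.choose j / 2 ^ (2 * p)) *
          neg_one_pow_mul_sub hj'
  · refine ⟨∑ j ∈ range (p + 1),
        (C (((2 * j).factorial * (2 * (p - j) + 1).factorial /
          (j.factorial * (p - j).factorial * (p + 1).factorial) : ℝ) *
            p.choose j / 2 ^ (2 * p + 1)) * X ^ (2 * j) +
        C (((2 * j + 1).factorial * (2 * (p - j)).factorial /
          (j.factorial * (p - j).factorial * (p + 1).factorial) : ℝ) *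
            p.choose j / 2 ^ (2 * p + 1)) * X ^ (2 * j + 1)), fun k => ?_, ?_, ?_, fun w => ?_⟩
    · rw [finsetSum_coeff]
      refine sum_nonneg fun j _ => ?_
      rw [coeff_add, coeff_C_mul, coeff_X_pow, coeff_C_mul, coeff_X_pow]
      split_ifs <;> positivity
    · refine natDegree_sum_le_of_forall_le _ _ fun j hj => ?_
      have := mem_range.1 hj
      refine natDegree_add_le_of_degree_le ((natDegree_C_mul_X_pow_le _ _).trans ?_)
        ((natDegree_C_mul_X_pow_le _ _).trans ?_) <;> omega
    · rw [finsetSum_coeff, sum_eq_single_of_mem p (by simp)]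
      · have h : ((2 * p + 1).choose p : ℝ) * (p + 1).factorial * p.factorial
            = (2 * p + 1).factorial := by
          rw [show 2 * p + 1 = p + 1 + p by ring]
          exact_mod_cast Nat.add_choose_mul_factorial_mul_factorial (p + 1) p
        rw [coeff_add, coeff_C_mul, coeff_C_mul, coeff_X_pow, coeff_X_pow, if_neg (by omega),
          if_pos rfl]
        simp only [Nat.sub_self, mul_zero, Nat.factorial_zero, Nat.cast_one, Nat.choose_self]
        rw [← h]
        field_simp
        ring
      · intro j _ hj
        rw [coeff_add, coeff_C_mul, coeff_C_mul, coeff_X_pow, coeff_X_pow, if_neg (by omega),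
          if_neg (by omega)]
        ring
    · rw [twist_eq, pow_one, mul_assoc, coeff_C_mul, sum_mul, finsetSum_coeff, eval_finsetSum,
        pow_one, mul_sum, mul_sum]
      refine sum_congr rfl fun j hj => ?_
      have hj' : j ≤ p := by have := mem_range.1 hj; omega
      have h1 := coeff_even_odd (p - j) j
      have h2 := coeff_odd_even (p - j) j
      rw [show j + (p - j) = p by omega] at h1 h2
      rw [show (C ((p.choose j : ℝ) * (-1) ^ j * w ^ (2 * j)) *
          ((X + 1) ^ (2 * j) * (X - 1) ^ (2 * (p - j))) * (X - 1 + C w * (X + 1)) : ℝ[X]) =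
          C ((p.choose j : ℝ) * (-1) ^ j * w ^ (2 * j)) *
            ((X + 1) ^ (2 * j) * (X - 1) ^ (2 * (p - j) + 1) +
              C w * ((X + 1) ^ (2 * j + 1) * (X - 1) ^ (2 * (p - j)))) by ring,
        coeff_C_mul, coeff_add, coeff_C_mul, h1, h2]
      simp only [eval_mul, eval_C, eval_pow, eval_X, eval_add]
      linear_combination (-w ^ (2 * j) * ((2 * j).factorial * (2 * (p - j) + 1).factorial /
        (j.factorial * (p - j).factorial * (p + 1).factorial) : ℝ) *
          p.choose j / 2 ^ (2 * p + 1) -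
        w ^ (2 * j + 1) * ((2 * j + 1).factorial * (2 * (p - j)).factorial /
        (j.factorial * (p - j).factorial * (p + 1).factorial) : ℝ) *
          p.choose j / 2 ^ (2 * p + 1)) * neg_one_pow_mul_sub hj'

lemma sum_fin_parity (p e : ℕ) (g : ℕ → ℝ) (hg : ∀ i, i % 2 ≠ e → g i = 0) :
    ∑ i : Fin (2 * p + e + 1), g i = ∑ a ∈ range (p + 1), g (2 * a + e) := by
  rw [Fin.sum_univ_eq_sum_range g,
    ← sum_image (s := range (p + 1)) (g := fun a => 2 * a + e) (f := g)
      (fun a _ b _ h => by simp only at h; omega)]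
  symm
  refine sum_subset (fun i hi => ?_) fun i hi hi' => hg i fun h => hi' ?_
  · obtain ⟨a, ha, rfl⟩ := mem_image.1 hi
    have := mem_range.1 ha
    exact mem_range.2 (by omega)
  · have := mem_range.1 hi
    exact mem_image.2 ⟨i / 2, mem_range.2 (by omega), by omega⟩

/-- Coefficients of a rescaled Laguerre polynomial `L_p^{(e)}(y / 2)`. -/
noncomputable def laguerreCoeff (p e a : ℕ) : ℝ :=
  ((p + e).choose (a + e) : ℝ) * (-1 / 2) ^ a / a.factorial

lemma twist_eq_laguerre (p e : ℕ) (he : e ≤ 1) (s : ℝ) :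
    (-1) ^ e * ((X + C (-s / 2) * (X + 1)) ^ p *
      (1 + C (-s / 2) * (X + 1)) ^ (p + e)).coeff (p + e) =
    ∑ a ∈ range (p + 1), ∑ b ∈ range (p + 1), 1 / (2 * (p + 1) : ℝ) ^ e *
      laguerreCoeff p e a * laguerreCoeff p e b * (a + b + e).factorial * s ^ (a + b + e) := by
  rw [coeff_twist, mul_sum]
  refine sum_congr rfl fun a _ => ?_
  have shift : ∀ f : ℕ → ℝ, (e = 1 → f 0 = 0) →
      ∑ b ∈ range (p + e + 1), f b = ∑ b ∈ range (p + 1), f (b + e) := by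
    intro f hf
    obtain rfl | rfl : e = 0 ∨ e = 1 := by omega
    · rfl
    · rw [sum_range_succ', hf rfl, add_zero]
  rw [shift _ (by rintro rfl; simp), mul_sum]
  refine sum_congr rfl fun b _ => ?_
  unfold laguerreCoeff
  rw [show -s / 2 = (-1 / 2) * s by ring, mul_pow, ← add_assoc]
  have h : ((a + b + e).choose (a + e) : ℝ) * b.factorial * (a + e).factorial
      = (a + b + e).factorial := by
    rw [show a + b + e = b + (a + e) by ring]
    exact_mod_cast Nat.add_choose_mul_factorial_mul_factorial b (a + e)
  rw [← h]
  obtain rfl | rfl : e = 0 ∨ e = 1 := by omega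
  · simp only [add_zero, pow_zero]
    field_simp
    ring
  · have h2 : ((p + 1).choose (a + 1) : ℝ) * (a + 1) = (p + 1) * p.choose a := by
      exact_mod_cast (Nat.add_one_mul_choose_eq p a).symm
    have h3 : ((p + 1).choose (a + 1) : ℝ) = (p + 1) * p.choose a / (a + 1) := by
      rw [← h2]; field_simp
    rw [h3, Nat.factorial_succ]
    push_cast
    field_simp
    ring

lemma coeff_comp_X_sub_one (P : ℝ[X]) (n l : ℕ) (hP : P.natDegree ≤ n) :
    (P.comp (X - 1)).coeff l =
      ∑ k ∈ Icc l n, (-1 : ℝ) ^ (k + l) * (k.choose l : ℝ) * P.coeff k := by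
  rw [comp_eq_sum_left, sum_over_range' _ (by simp) (n + 1) (by omega), finsetSum_coeff]
  have hsub : Icc l n ⊆ range (n + 1) := fun k hk => by
    have := mem_Icc.1 hk
    exact mem_range.2 (by omega)
  rw [← sum_subset hsub]
  · refine sum_congr rfl fun k hk => ?_
    obtain ⟨d, rfl⟩ := Nat.exists_eq_add_of_le (mem_Icc.1 hk).1
    rw [show (X - 1 : ℝ[X]) = X + C (-1) by simp [sub_eq_add_neg], coeff_C_mul,
      coeff_X_add_C_pow, show l + d - l = d by omega, show l + d + l = d + (l + l) by ring,
      pow_add, Even.neg_one_pow ⟨l, rfl⟩]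
    ring
  · intro k hk hk'
    have hlt : k < l := by
      by_contra h
      exact hk' (mem_Icc.2 ⟨by omega, by have := mem_range.1 hk; omega⟩)
    rw [show (X - 1 : ℝ[X]) = X + C (-1) by simp [sub_eq_add_neg], coeff_C_mul,
      coeff_X_add_C_pow, Nat.choose_eq_zero_of_lt hlt]
    simp

/-- A rank-one feasible point attaining the claimed value. -/
lemma exists_feasible (p e : ℕ) (he : e ≤ 1) :
    ∃ (Q : Matrix (Fin (2 * p + e + 1)) (Fin (2 * p + e + 1)) ℝ) (F : ℕ → ℝ),
    Q.PosSemidef ∧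
    (∑ k ∈ Finset.range (2 * p + e + 1), F k) = 1 ∧
    (∀ k ≤ 2 * p + e, 0 ≤ F k) ∧
    (∀ l, 1 ≤ l → l ≤ 2 * p + e →
      (∑ i : Fin (2 * p + e + 1), ∑ j : Fin (2 * p + e + 1),
        if i.val + j.val = 2 * l - 1 then Q i j else 0) = 0) ∧
    (∀ l ≤ 2 * p + e,
      (∑ i : Fin (2 * p + e + 1), ∑ j : Fin (2 * p + e + 1),
        if i.val + j.val = 2 * l then Q i j else 0)
      = ∑ k ∈ Finset.Icc l (2 * p + e),
          ((-1 : ℝ) ^ (k + l) / (l.factorial : ℝ)) * (k.choose l : ℝ) * F k) ∧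
    ((2 * p + e).choose p : ℝ) / 2 ^ (2 * p + e) = F (2 * p + e) := by
  obtain ⟨P, hpos, hdeg, htop, heval⟩ := exists_nonneg_poly p e he
  let κ : ℝ := 1 / (2 * (p + 1) : ℝ) ^ e
  let d : ℕ → ℝ := fun i => if i % 2 = e then laguerreCoeff p e (i / 2) else 0
  have hd0 : ∀ i, i % 2 ≠ e → d i = 0 := fun i hi => if_neg hi
  have hd : ∀ a, d (2 * a + e) = laguerreCoeff p e a := fun a => by
    simp only [d]
    rw [if_pos (by omega), show (2 * a + e) / 2 = a by omega]
  refine ⟨κ • Matrix.vecMulVec (fun i : Fin (2 * p + e + 1) => d i)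
    (star fun i : Fin (2 * p + e + 1) => d i), P.coeff, ?_, ?_,
    fun k _ => hpos k, ?_, ?_, htop.symm⟩
  · exact (Matrix.posSemidef_vecMulVec_self_star _).smul (by positivity)
  · have h := heval 1
    rw [eval_eq_sum_range' (n := 2 * p + e + 1) (by omega)] at h
    simp only [one_pow, mul_one] at h
    rw [h, show (-(1 + 1) / 2 : ℝ) = -1 by norm_num,
      show (X + C (-1) * (X + 1) : ℝ[X]) = C (-1) by simp,
      show (1 + C (-1) * (X + 1) : ℝ[X]) = C (-1) * X by simp, mul_pow, ← mul_assoc, ← pow_add,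
      ← C_pow, coeff_C_mul, coeff_X_pow, if_pos rfl, mul_one, ← pow_add,
      show e + (p + (p + e)) = (p + e) + (p + e) by ring, Even.neg_one_pow ⟨p + e, rfl⟩]
  · intro l hl _
    refine sum_eq_zero fun i _ => sum_eq_zero fun j _ => ?_
    split_ifs with h
    · simp only [Matrix.smul_apply, Matrix.vecMulVec_apply, star_trivial, smul_eq_mul]
      by_cases hi : i.val % 2 = e
      · rw [hd0 j (by omega)]; ring
      · rw [hd0 i hi]; ring
    · rfl
  · intro l _
    have hsum : (∑ i : Fin (2 * p + e + 1), ∑ j : Fin (2 * p + e + 1),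
        if i.val + j.val = 2 * l then
          (κ • Matrix.vecMulVec (fun i : Fin (2 * p + e + 1) => d i)
            (star fun i : Fin (2 * p + e + 1) => d i)) i j
        else 0) =
        ∑ a ∈ range (p + 1), ∑ b ∈ range (p + 1),
          if l = a + b + e then κ * laguerreCoeff p e a * laguerreCoeff p e b else 0 := by
      simp only [Matrix.smul_apply, Matrix.vecMulVec_apply, star_trivial, smul_eq_mul]
      rw [sum_fin_parity p e (fun i => ∑ j : Fin (2 * p + e + 1),
        if i + j.val = 2 * l then κ * (d i * d j) else 0) fun i hi => by simp [hd0 i hi]]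
      refine sum_congr rfl fun a _ => ?_
      rw [sum_fin_parity p e (fun j => if 2 * a + e + j = 2 * l then
        κ * (d (2 * a + e) * d j) else 0) fun j hj => by simp [hd0 j hj]]
      refine sum_congr rfl fun b _ => ?_
      rw [hd, hd, mul_assoc]
      exact if_congr (by omega) rfl rfl
    have hcomp : P.comp (X - 1) = ∑ a ∈ range (p + 1), ∑ b ∈ range (p + 1),
        C (κ * laguerreCoeff p e a * laguerreCoeff p e b * (a + b + e).factorial) *
          X ^ (a + b + e) := by
      refine Polynomial.funext fun s => ?_
      have h := twist_eq_laguerre p e he s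
      rw [eval_comp, eval_sub, eval_X, eval_one, heval, show -(1 + (s - 1)) / 2 = -s / 2 by ring, h]
      simp only [eval_finsetSum, eval_mul, eval_C, eval_pow, eval_X]
      rfl
    have h := coeff_comp_X_sub_one P (2 * p + e) l hdeg
    rw [hcomp] at h
    have hfac : (l.factorial : ℝ) ≠ 0 := by positivity
    rw [hsum, ← mul_right_inj' hfac, mul_sum (Icc l (2 * p + e))]
    calc _ = _ := ?_
      _ = _ := h
      _ = _ := sum_congr rfl fun k _ => by field_simp
    simp only [finsetSum_coeff, mul_sum, coeff_C_mul, coeff_X_pow]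
    refine sum_congr rfl fun a _ => sum_congr rfl fun b _ => ?_
    split_ifs with hl
    · rw [hl]; ring
    · ring

/-- The moments `2 ^ l * l!` as a sum of rank-one terms. -/
lemma moment_decomp (n a b e : ℕ) (he : e ≤ 1) (hb : b ≤ n) :
    (2 : ℝ) ^ (a + b + e) * (a + b + e).factorial =
      ∑ r ∈ range (n + 1), (2 / (r + 1) : ℝ) ^ e *
        ((2 ^ a * (a + e).factorial * a.choose r) * (2 ^ b * (b + e).factorial * b.choose r)) := by
  have hv : ((a + b + e).choose b : ℝ) =
      ∑ r ∈ range (n + 1), (a.choose r : ℝ) * (b + e).choose (r + e) := by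
    have h := Nat.add_choose_eq a (b + e) b
    rw [Nat.sum_antidiagonal_eq_sum_range_succ_mk, ← add_assoc] at h
    rw [h, Nat.cast_sum,
      ← sum_subset (s₁ := range b.succ) (range_subset_range.2 (Nat.succ_le_succ hb))]
    · refine sum_congr rfl fun r hr => ?_
      have hr' : r ≤ b := Nat.lt_succ_iff.1 (mem_range.1 hr)
      rw [Nat.cast_mul, ← Nat.choose_symm (show b - r ≤ b + e by omega),
        show b + e - (b - r) = r + e by omega]
    · intro r _ hr
      rw [Nat.choose_eq_zero_of_lt (show b + e < r + e by
        have := mt mem_range.2 hr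
        omega), Nat.cast_zero, mul_zero]
  have hf : ((a + b + e).choose b : ℝ) * (a + e).factorial * b.factorial =
      (a + b + e).factorial := by
    rw [show a + b + e = a + e + b by ring]
    exact_mod_cast Nat.add_choose_mul_factorial_mul_factorial (a + e) b
  rw [← hf, hv, sum_mul, sum_mul, mul_sum]
  refine sum_congr rfl fun r _ => ?_
  obtain rfl | rfl : e = 0 ∨ e = 1 := by omega
  · simp only [add_zero, pow_zero, pow_add]
    ring
  · have h2 : ((b + 1).choose (r + 1) : ℝ) * (r + 1) = (b + 1) * b.choose r := by
      exact_mod_cast (Nat.add_one_mul_choose_eq b r).symm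
    have h3 : ((b + 1).choose (r + 1) : ℝ) = (b + 1) * b.choose r / (r + 1) := by
      rw [← h2]; field_simp
    rw [h3, Nat.factorial_succ b]
    push_cast
    field_simp
    ring

/-- The moment matrix entry pairing `x ^ i` with `x ^ j`. -/
noncomputable def moment (i j : ℕ) : ℝ :=
  if (i + j) % 2 = 0 then 2 ^ ((i + j) / 2) * ((i + j) / 2).factorial else 0

/-- Vectors of a triangular factorization of the moment matrix. -/
noncomputable def momentVec (ε r i : ℕ) : ℝ :=
  if i % 2 = ε then 2 ^ (i / 2) * (i / 2 + ε).factorial * (i / 2).choose r else 0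

lemma moment_eq_sum (n i j : ℕ) (hj : j ≤ n) :
    moment i j = ∑ ε ∈ range 2, ∑ r ∈ range (n + 1),
      (2 / (r + 1) : ℝ) ^ ε * (momentVec ε r i * momentVec ε r j) := by
  have key : ∀ ε ≤ 1, i % 2 = ε → moment i j = ∑ r ∈ range (n + 1),
      (2 / (r + 1) : ℝ) ^ ε * (momentVec ε r i * momentVec ε r j) := by
    intro ε hε hi
    by_cases hj' : j % 2 = ε
    · simp only [moment, momentVec, if_pos hi, if_pos hj']
      rw [if_pos (by omega), show (i + j) / 2 = i / 2 + j / 2 + ε by omega,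
        moment_decomp n (i / 2) (j / 2) ε hε (by omega)]
    · simp only [moment, momentVec, if_neg hj']
      rw [if_neg (by omega)]
      simp
  have zero : ∀ ε, i % 2 ≠ ε → ∑ r ∈ range (n + 1),
      (2 / (r + 1) : ℝ) ^ ε * (momentVec ε r i * momentVec ε r j) = 0 := by
    intro ε hi
    simp [momentVec, if_neg hi]
  rw [sum_range_succ, sum_range_one]
  rcases Nat.mod_two_eq_zero_or_one i with h | h
  · rw [key 0 (by omega) h, zero 1 (by omega), add_zero]
  · rw [key 1 le_rfl h, zero 0 (by omega), zero_add]

/-- Pairing a feasible matrix with the moment matrix gives the total mass. -/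
lemma sum_moment (n : ℕ) (Q : Matrix (Fin (n + 1)) (Fin (n + 1)) ℝ) (F : ℕ → ℝ)
    (h : ∀ l ≤ n, (∑ i : Fin (n + 1), ∑ j : Fin (n + 1),
        if i.val + j.val = 2 * l then Q i j else 0)
      = ∑ k ∈ Finset.Icc l n,
          ((-1 : ℝ) ^ (k + l) / (l.factorial : ℝ)) * (k.choose l : ℝ) * F k) :
    ∑ i : Fin (n + 1), ∑ j : Fin (n + 1), Q i j * moment i j = ∑ k ∈ range (n + 1), F k := by
  have h1 : ∀ i j : Fin (n + 1), Q i j * moment i j = ∑ l ∈ range (n + 1),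
      (2 : ℝ) ^ l * l.factorial * (if i.val + j.val = 2 * l then Q i j else 0) := by
    intro i j
    unfold moment
    have hi := i.isLt
    have hj := j.isLt
    split_ifs with hij
    · rw [sum_eq_single_of_mem ((i.val + j.val) / 2) (mem_range.2 (by omega)), if_pos (by omega)]
      · ring
      · intro l _ hl
        rw [if_neg (by omega), mul_zero]
    · rw [mul_zero, sum_eq_zero fun l _ => ?_]
      rw [if_neg (by omega), mul_zero]
  let P : ℝ[X] := ∑ k ∈ range (n + 1), C (F k) * X ^ k
  have hP : P.natDegree ≤ n := natDegree_sum_le_of_forall_le _ _ fun k hk =>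
    (natDegree_C_mul_X_pow_le _ _).trans (Nat.lt_succ_iff.1 (mem_range.1 hk))
  have hc : ∀ k ≤ n, P.coeff k = F k := by
    intro k hk
    simp only [P, finsetSum_coeff, coeff_C_mul, coeff_X_pow, mul_ite, mul_one, mul_zero]
    rw [sum_ite_eq, if_pos (mem_range.2 (by omega))]
  have hdeg : (P.comp (X - 1)).natDegree < n + 1 := by
    refine Nat.lt_succ_iff.2 (natDegree_comp_le.trans ?_)
    rw [show (X - 1 : ℝ[X]) = X - C 1 by simp, natDegree_X_sub_C, mul_one]
    exact hP
  calc _ = ∑ l ∈ range (n + 1), (2 : ℝ) ^ l * l.factorial *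
        ∑ i : Fin (n + 1), ∑ j : Fin (n + 1), if i.val + j.val = 2 * l then Q i j else 0 := by
        simp only [h1, mul_sum]
        rw [sum_congr rfl fun i _ => sum_comm, sum_comm]
    _ = ∑ l ∈ range (n + 1), (P.comp (X - 1)).coeff l * 2 ^ l := by
        refine sum_congr rfl fun l hl => ?_
        rw [h l (Nat.lt_succ_iff.1 (mem_range.1 hl)), coeff_comp_X_sub_one P n l hP, mul_sum,
          sum_mul]
        refine sum_congr rfl fun k hk => ?_
        rw [hc k (mem_Icc.1 hk).2]
        field_simp
    _ = (P.comp (X - 1)).eval 2 := (eval_eq_sum_range' hdeg 2).symm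
    _ = ∑ k ∈ range (n + 1), F k := by
        rw [eval_comp, eval_sub, eval_X, eval_one, show (2 - 1 : ℝ) = 1 by norm_num]
        simp [P, eval_finsetSum]

/-- Weak duality: every feasible point has value at most the claimed one. -/
lemma le_of_feasible (p e : ℕ) (he : e ≤ 1)
    (Q : Matrix (Fin (2 * p + e + 1)) (Fin (2 * p + e + 1)) ℝ) (F : ℕ → ℝ) (hQ : Q.PosSemidef)
    (hF : ∑ k ∈ range (2 * p + e + 1), F k = 1)
    (h : ∀ l ≤ 2 * p + e, (∑ i : Fin (2 * p + e + 1), ∑ j : Fin (2 * p + e + 1),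
        if i.val + j.val = 2 * l then Q i j else 0)
      = ∑ k ∈ Finset.Icc l (2 * p + e),
          ((-1 : ℝ) ^ (k + l) / (l.factorial : ℝ)) * (k.choose l : ℝ) * F k) :
    F (2 * p + e) ≤ ((2 * p + e).choose p : ℝ) / 2 ^ (2 * p + e) := by
  have single : ∀ g : Fin (2 * p + e + 1) → Fin (2 * p + e + 1) → ℝ,
      (∀ i j, i.val ≠ 2 * p + e ∨ j.val ≠ 2 * p + e → g i j = 0) →
      ∑ i, ∑ j, g i j = g (Fin.last _) (Fin.last _) := by
    intro g hg
    rw [sum_eq_single_of_mem (Fin.last _) (mem_univ _),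
      sum_eq_single_of_mem (Fin.last _) (mem_univ _)]
    · exact fun j _ hj => hg _ _ (Or.inr fun h => hj (Fin.ext h))
    · exact fun i _ hi => sum_eq_zero fun j _ => hg _ _ (Or.inl fun h => hi (Fin.ext h))
  have hlast : Q (Fin.last _) (Fin.last _) = F (2 * p + e) / (2 * p + e).factorial := by
    have h1 := h (2 * p + e) le_rfl
    rw [single, Icc_self, sum_singleton, Even.neg_one_pow ⟨_, rfl⟩, Nat.choose_self] at h1
    · rw [if_pos (by simp only [Fin.val_last]; ring)] at h1
      rw [h1, Nat.cast_one]
      ring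
    · intro i j hij
      have := i.isLt
      have := j.isLt
      exact if_neg (by omega)
  let T : ℕ → ℕ → ℝ := fun ε r => ∑ i : Fin (2 * p + e + 1), ∑ j : Fin (2 * p + e + 1),
    Q i j * (momentVec ε r i * momentVec ε r j)
  have hT : ∀ ε r, 0 ≤ T ε r := by
    intro ε r
    have := hQ.dotProduct_mulVec_nonneg (fun i => momentVec ε r i)
    refine this.trans_eq ?_
    simp only [T, dotProduct, Matrix.mulVec, star_trivial, mul_sum]
    exact sum_congr rfl fun i _ => sum_congr rfl fun j _ => by ring
  have hsum : ∑ ε ∈ range 2, ∑ r ∈ range (2 * p + e + 1), (2 / (r + 1) : ℝ) ^ ε * T ε r = 1 := by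
    rw [← sum_moment _ Q F h] at hF
    refine Eq.trans ?_ hF
    have h1 : ∀ i j : Fin (2 * p + e + 1), Q i j * moment i j =
        ∑ ε ∈ range 2, ∑ r ∈ range (2 * p + e + 1),
          (2 / (r + 1) : ℝ) ^ ε * (Q i j * (momentVec ε r i * momentVec ε r j)) := by
      intro i j
      rw [moment_eq_sum (2 * p + e) i j (Nat.lt_succ_iff.1 j.isLt), mul_sum]
      refine sum_congr rfl fun ε _ => ?_
      rw [mul_sum]
      exact sum_congr rfl fun r _ => by ring
    simp only [h1, T, mul_sum]
    simp only [sum_comm (s := (univ : Finset (Fin (2 * p + e + 1)))) (t := range _)]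
  have hle : (2 / (p + 1) : ℝ) ^ e * T e p ≤ 1 := by
    refine le_of_le_of_eq ?_ hsum
    have hnn : ∀ ε r : ℕ, 0 ≤ (2 / (r + 1) : ℝ) ^ ε * T ε r := fun ε r =>
      mul_nonneg (by positivity) (hT ε r)
    refine le_trans ?_ (single_le_sum (f := fun ε => ∑ r ∈ range (2 * p + e + 1),
      (2 / (r + 1) : ℝ) ^ ε * T ε r) (fun ε _ => sum_nonneg fun r _ => hnn ε r)
      (mem_range.2 (by omega : e < 2)))
    exact single_le_sum (f := fun r : ℕ => (2 / (r + 1) : ℝ) ^ e * T e r)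
      (fun r _ => hnn e r) (mem_range.2 (by omega : p < 2 * p + e + 1))
  have hTe : T e p = F (2 * p + e) / (2 * p + e).factorial * (2 ^ p * (p + e).factorial) ^ 2 := by
    have hv : ∀ i < 2 * p + e, momentVec e p i = 0 := by
      intro i hi
      unfold momentVec
      split_ifs
      · rw [Nat.choose_eq_zero_of_lt (by omega), Nat.cast_zero, mul_zero]
      · rfl
    simp only [T]
    rw [single, hlast]
    · simp only [momentVec, Fin.val_last]
      rw [if_pos (by omega), show (2 * p + e) / 2 = p by omega, Nat.choose_self]
      push_cast
      ring
    · intro i j hij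
      have := i.isLt
      have := j.isLt
      rcases hij with hi | hj
      · rw [hv i (by omega)]; ring
      · rw [hv j (by omega)]; ring
  have hch : ((2 * p + e).choose p : ℝ) * (p + e).factorial * p.factorial
      = (2 * p + e).factorial := by
    rw [show 2 * p + e = p + e + p by ring]
    exact_mod_cast Nat.add_choose_mul_factorial_mul_factorial (p + e) p
  have hC : (0 : ℝ) < (2 * p + e).choose p := by
    exact_mod_cast Nat.choose_pos (by omega)
  have hfin : (2 / (p + 1) : ℝ) ^ e * T e p =
      F (2 * p + e) / (((2 * p + e).choose p : ℝ) / 2 ^ (2 * p + e)) := by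
    rw [hTe, ← hch]
    obtain rfl | rfl : e = 0 ∨ e = 1 := by omega
    · simp only [add_zero, pow_zero] at hC ⊢
      field_simp
      ring
    · rw [Nat.factorial_succ]
      push_cast
      field_simp
      ring
  rw [hfin] at hle
  exact (div_le_one (by positivity)).1 hle

/-- for `n ≥ 1`, the optimal value of `(SDP^{n,≤}_n)` (level `m = n` of the
hierarchy of restrictions) equals `2^{-n} C(n, ⌊n/2⌋)`. -/
theorem restriction_level_n_value (n : ℕ) (hn : 1 ≤ n) :
    sdpRestrVal n n = (n.choose (n / 2) : ℝ) / 2 ^ n := by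
  obtain ⟨p, e, he, rfl⟩ : ∃ p e, e ≤ 1 ∧ n = 2 * p + e :=
    ⟨n / 2, n % 2, by omega, by omega⟩
  rw [show (2 * p + e) / 2 = p by omega]
  refine IsGreatest.csSup_eq ⟨exists_feasible p e he, ?_⟩
  rintro v ⟨Q, F, hQ, hF, -, -, h, rfl⟩
  exact le_of_feasible p e he Q F hQ hF h
end

section
/- For all natural numbers t and s with s ≤ t, the following binomial identity holds: ∑_{k=s+1}^{t} (1/(2^{2t} · (2s+1)!)) · C(2k, 2s+1) · C(2k, k) · C(2t−2k, t−k) = ∑_{i=0}^{2t−2s−1} (i! · (2t−2s−i−1)!/(2^{2s+1} · (2t)!)) · C(2t, t) · C(t, i)² · C(t, 2t−2s−i−1)². -/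
open Polynomial Finset

/-- Von Szily's identity: the middle coefficient of `(1 + X) ^ (2 * m) * (-(1 - X) ^ 2) ^ n` is the
super Catalan number. -/
lemma coeff_one_add_pow_mul_one_sub_pow (m n : ℕ) :
    ((((1 + X) ^ 2) ^ m * (-(1 - X) ^ 2) ^ n : ℝ[X])).coeff (m + n) =
      ((2 * m).factorial * (2 * n).factorial : ℝ) /
        (m.factorial * n.factorial * (m + n).factorial) := by
  induction n generalizing m with
  | zero =>
    have h := Nat.add_choose_mul_factorial_mul_factorial m m
    rw [← two_mul] at h
    have h' : ((2 * m).choose m : ℝ) * m.factorial * m.factorial = (2 * m).factorial := by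
      exact_mod_cast h
    rw [← pow_mul, pow_zero, mul_one, add_zero, coeff_one_add_X_pow, ← h']
    field_simp
  | succ n ih =>
    have key : (((1 + X) ^ 2) ^ m * (-(1 - X) ^ 2) ^ (n + 1) : ℝ[X]) =
        C 4 * (((1 + X) ^ 2) ^ m * (-(1 - X) ^ 2) ^ n) * X -
          ((1 + X) ^ 2) ^ (m + 1) * (-(1 - X) ^ 2) ^ n := by
      rw [show (C 4 : ℝ[X]) = 4 from rfl]
      ring
    have ih' := ih (m + 1)
    rw [show m + 1 + n = m + n + 1 by ring] at ih'
    rw [key, ← add_assoc, coeff_sub, coeff_mul_X, coeff_C_mul, ih m, ih']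
    simp only [show 2 * (m + 1) = 2 * m + 1 + 1 by ring, show 2 * (n + 1) = 2 * n + 1 + 1 by ring,
      Nat.factorial_succ]
    push_cast
    field_simp
    ring

lemma choose_mul_coeff_one_add_pow_mul_one_sub_pow {t k : ℕ} (hk : k ≤ t) :
    (t.choose k : ℝ) * ((((1 + X) ^ 2) ^ k * (-(1 - X) ^ 2) ^ (t - k) : ℝ[X])).coeff t =
      ((2 * k).choose k : ℝ) * ((2 * t - 2 * k).choose (t - k) : ℝ) := by
  obtain ⟨n, rfl⟩ := Nat.exists_eq_add_of_le hk
  rw [show 2 * (k + n) - 2 * k = 2 * n by omega, Nat.add_sub_cancel_left,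
    coeff_one_add_pow_mul_one_sub_pow, Nat.cast_add_choose, two_mul k, two_mul n,
    Nat.cast_add_choose, Nat.cast_add_choose]
  field_simp

lemma coeff_pow_mul_pow_eq_sum_choose (t : ℕ) (z : ℝ) :
    ((X + C z * (1 + X)) ^ t * (1 + C z * (1 + X)) ^ t : ℝ[X]).coeff t =
      ∑ a ∈ range (t + 1), ∑ b ∈ range (t + 1),
        ((a + b).choose a : ℝ) * t.choose a * t.choose b * z ^ (a + b) := by
  rw [add_comm X, add_comm (1 : ℝ[X]) (C z * _), add_pow, add_pow, sum_mul_sum, finsetSum_coeff]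
  refine sum_congr rfl fun a ha => ?_
  rw [finsetSum_coeff]
  refine sum_congr rfl fun b _ => ?_
  have ha' : a ≤ t := Nat.lt_succ_iff.mp (mem_range.mp ha)
  rw [show ((C z * (1 + X)) ^ a * X ^ (t - a) * (t.choose a : ℝ[X]) *
      ((C z * (1 + X)) ^ b * 1 ^ (t - b) * (t.choose b : ℝ[X]))) =
      C (z ^ (a + b) * t.choose a * t.choose b) * ((1 + X) ^ (a + b) * X ^ (t - a)) by
    simp only [C_mul, C_pow, map_natCast, mul_pow]
    ring]
  rw [coeff_C_mul, coeff_mul_X_pow', if_pos (Nat.sub_le t a), Nat.sub_sub_self ha',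
    coeff_one_add_X_pow]
  ring

lemma sum_centralBinom_mul_pow (t : ℕ) (z : ℝ) :
    ∑ k ∈ range (t + 1), ((2 * k).choose k : ℝ) * ((2 * t - 2 * k).choose (t - k) : ℝ) *
        (1 + 2 * z) ^ (2 * k) =
      4 ^ t * ∑ a ∈ range (t + 1), ∑ b ∈ range (t + 1),
        ((a + b).choose a : ℝ) * t.choose a * t.choose b * z ^ (a + b) := by
  have key : (C ((1 + 2 * z) ^ 2) * (1 + X) ^ 2 + -(1 - X) ^ 2 : ℝ[X]) ^ t =
      C (4 ^ t) * ((X + C z * (1 + X)) ^ t * (1 + C z * (1 + X)) ^ t) := by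
    rw [C_pow (a := (4 : ℝ)), ← mul_pow, ← mul_pow]
    congr 1
    simp only [C_pow, C_add, C_mul, C_1, C_ofNat]
    ring
  rw [← coeff_pow_mul_pow_eq_sum_choose, ← coeff_C_mul, ← key, add_pow, finsetSum_coeff]
  refine sum_congr rfl fun k hk => ?_
  rw [← choose_mul_coeff_one_add_pow_mul_one_sub_pow (Nat.lt_succ_iff.mp (mem_range.mp hk)),
    mul_pow, ← C_pow, ← C_eq_natCast, mul_assoc (C _), mul_assoc (C _), coeff_C_mul, coeff_mul_C, pow_mul (1 + 2 * z)]
  rw [mul_comm, mul_comm (coeff _ _)]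

/-- Coefficientwise form of Howell's formula
`4 ^ t * L_t(x) ^ 2 = ∑ k, C(2k, k) * C(2t - 2k, t - k) * L_{2k}(2x)` for Laguerre polynomials. -/
lemma sum_choose_mul_centralBinom (t l : ℕ) :
    ∑ k ∈ range (t + 1), ((2 * k).choose k : ℝ) * ((2 * t - 2 * k).choose (t - k) : ℝ) *
        (2 ^ l * (2 * k).choose l) =
      4 ^ t * ∑ a ∈ range (t + 1), ∑ b ∈ range (t + 1),
        if a + b = l then ((a + b).choose a : ℝ) * t.choose a * t.choose b else 0 := by
  have key : (∑ k ∈ range (t + 1),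
      C (((2 * k).choose k : ℝ) * ((2 * t - 2 * k).choose (t - k) : ℝ)) *
        ((1 + X) ^ (2 * k)).comp (C 2 * X) : ℝ[X]) =
      C (4 ^ t) * ∑ a ∈ range (t + 1), ∑ b ∈ range (t + 1),
        C (((a + b).choose a : ℝ) * t.choose a * t.choose b) * X ^ (a + b) := by
    refine Polynomial.funext fun z => ?_
    simpa [eval_finsetSum] using sum_centralBinom_mul_pow t z
  have h := congrArg (fun p => coeff p l) key
  simpa only [finsetSum_coeff, coeff_C_mul, comp_C_mul_X_coeff, coeff_one_add_X_pow, coeff_X_pow,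
    mul_ite, mul_one, mul_zero, eq_comm (a := l), mul_comm (2 ^ l : ℝ)] using h

lemma sum_sum_ite_add_eq (t m : ℕ) (g : ℕ → ℕ → ℝ) (hl : ∀ i j, t < i → g i j = 0)
    (hr : ∀ i j, t < j → g i j = 0) :
    ∑ i ∈ range (t + 1), ∑ j ∈ range (t + 1), (if i + j = m then g i j else 0) =
      ∑ i ∈ range (m + 1), g i (m - i) := by
  have inner (i : ℕ) : ∑ j ∈ range (t + 1), (if i + j = m then g i j else 0) =
      if i ≤ m then g i (m - i) else 0 := by
    split_ifs with him
    · rw [sum_eq_single (m - i)]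
      · rw [if_pos (by omega)]
      · intro j _ hj
        rw [if_neg (by omega)]
      · intro hj
        rw [hr i (m - i) (by rw [mem_range] at hj; omega), ite_self]
    · exact sum_eq_zero fun j _ => if_neg (by omega)
  simp only [inner]
  rw [← sum_filter]
  refine sum_subset_zero_on_sdiff ?_ ?_ fun _ _ => rfl
  · intro i hi
    simp only [mem_filter, mem_range] at hi ⊢
    omega
  · intro i hi
    simp only [mem_sdiff, mem_filter, mem_range] at hi
    exact hl i _ (by omega)

lemma sum_sum_ite_choose_reflect {t l m : ℕ} (h : l + m = 2 * t) :
    (∑ a ∈ range (t + 1), ∑ b ∈ range (t + 1),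
        if a + b = l then ((a + b).choose a : ℝ) * t.choose a * t.choose b else 0) =
      ∑ i ∈ range (m + 1), (l.factorial : ℝ) / (t.factorial : ℝ) ^ 2 *
        (i.factorial * (m - i).factorial * (t.choose i : ℝ) ^ 2 * (t.choose (m - i) : ℝ) ^ 2) := by
  rw [← sum_sum_ite_add_eq t m fun i j => (l.factorial : ℝ) / (t.factorial : ℝ) ^ 2 *
        (i.factorial * j.factorial * (t.choose i : ℝ) ^ 2 * (t.choose j : ℝ) ^ 2)]
  · rw [← sum_range_reflect]
    refine sum_congr rfl fun i hi => ?_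
    rw [← sum_range_reflect]
    refine sum_congr rfl fun j hj => ?_
    have hi' : i ≤ t := Nat.lt_succ_iff.mp (mem_range.mp hi)
    have hj' : j ≤ t := Nat.lt_succ_iff.mp (mem_range.mp hj)
    simp only [Nat.add_sub_cancel]
    by_cases hij : i + j = m
    · have hl : t - i + (t - j) = l := by omega
      rw [if_pos hl, if_pos hij, Nat.cast_add_choose, hl, Nat.choose_symm hi', Nat.choose_symm hj',
        Nat.cast_choose ℝ hi', Nat.cast_choose ℝ hj']
      field_simp
    · rw [if_neg (by omega), if_neg hij]
  · intro i j hi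
    simp [Nat.choose_eq_zero_of_lt hi]
  · intro i j hj
    simp [Nat.choose_eq_zero_of_lt hj]



/-- the binomial identity (even case `n = 2t`, odd `l = 2s+1`) proved via
Zeilberger's algorithm, with the convention `C(a,b) = 0` when `b > a`. -/
theorem zeilberger_identity_odd (t s : ℕ) (hst : s ≤ t) :
    (∑ k ∈ Finset.Icc (s + 1) t,
      (1 / ((2 : ℝ) ^ (2 * t) * ((2 * s + 1).factorial : ℝ))) *
        ((2 * k).choose (2 * s + 1) : ℝ) * ((2 * k).choose k : ℝ) *
        ((2 * t - 2 * k).choose (t - k) : ℝ))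
    = ∑ i ∈ Finset.range (2 * t - 2 * s),
      (((i.factorial : ℝ) * ((2 * t - 2 * s - i - 1).factorial : ℝ)) /
          ((2 : ℝ) ^ (2 * s + 1) * ((2 * t).factorial : ℝ))) *
        ((2 * t).choose t : ℝ) * ((t.choose i : ℝ)) ^ 2 *
        ((t.choose (2 * t - 2 * s - i - 1) : ℝ)) ^ 2 := by
  rcases hst.eq_or_lt with rfl | hlt
  · simp
  have h := sum_choose_mul_centralBinom t (2 * s + 1)
  rw [sum_sum_ite_choose_reflect (m := 2 * t - 2 * s - 1) (by omega), ← mul_sum,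
    show 2 * t - 2 * s - 1 + 1 = 2 * t - 2 * s by omega] at h
  have hsub : ∑ k ∈ Icc (s + 1) t, ((2 * k).choose k : ℝ) *
        ((2 * t - 2 * k).choose (t - k) : ℝ) * (2 ^ (2 * s + 1) * (2 * k).choose (2 * s + 1)) =
      ∑ k ∈ range (t + 1), ((2 * k).choose k : ℝ) *
        ((2 * t - 2 * k).choose (t - k) : ℝ) * (2 ^ (2 * s + 1) * (2 * k).choose (2 * s + 1)) := by
    refine sum_subset (fun k hk => ?_) fun k hk hk' => ?_
    · simp only [mem_Icc, mem_range] at hk ⊢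
      omega
    · simp only [mem_Icc, mem_range] at hk hk'
      simp [Nat.choose_eq_zero_of_lt (show 2 * k < 2 * s + 1 by omega)]
  rw [← hsub] at h
  have hchoose : ((2 * t).choose t : ℝ) = (2 * t).factorial / (t.factorial : ℝ) ^ 2 := by
    rw [two_mul, Nat.cast_add_choose, sq]
  calc
    _ = 1 / ((2 : ℝ) ^ (2 * t) * (2 * s + 1).factorial * 2 ^ (2 * s + 1)) *
        ∑ k ∈ Icc (s + 1) t, ((2 * k).choose k : ℝ) * ((2 * t - 2 * k).choose (t - k) : ℝ) *
          (2 ^ (2 * s + 1) * (2 * k).choose (2 * s + 1)) := by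
      rw [mul_sum]
      refine sum_congr rfl fun k _ => ?_
      field_simp
    _ = _ := by
      rw [h, hchoose, pow_mul 2 2 t, show (2 : ℝ) ^ 2 = 4 by norm_num, mul_sum, mul_sum, mul_sum]
      refine sum_congr rfl fun i _ => ?_
      rw [show 2 * t - 2 * s - 1 - i = 2 * t - 2 * s - i - 1 by omega]
      field_simp
end
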